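/- (Gronwall-type bound for higher derivatives of a flow.) Let F : ℝ^n → ℝ^n be C^{k+1} with all derivatives up to order k+1 bounded by M_k, and let Φ(t, p) denote the flow of ṗ = F(p), assumed to exist for t ∈ [0, L]. Then for each multi-index β with 1 ≤ |β| ≤ k there is a constant C(M_k, k, n) such that ‖∂_p^β Φ(t, p)‖ ≤ e^{C(M_k) (1 + t)} for all t ∈ [0, L] and all p; in particular ‖∂_p^β Φ(t, ·)‖_{L^∞} ≤ e^{C(M_k) L} on [0, L]. -/

import Mathlib

open Set Filter Topology
set_option linter.unusedSectionVars false
namespace FlowAux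
noncomputable section
universe u
variable {E F G : Type u} [NormedAddCommGroup E] [NormedSpace ℝ E]
  [NormedAddCommGroup F] [NormedSpace ℝ F] [NormedAddCommGroup G] [NormedSpace ℝ G]

abbrev I := unitInterval

/-- pointwise application of a bilinear map to paths -/
def appCLM (B : G →L[ℝ] E →L[ℝ] F) : C(I, G) →L[ℝ] C(I, E) →L[ℝ] C(I, F) :=
  LinearMap.mkContinuous₂
    (LinearMap.mk₂ ℝ (fun (A : C(I, G)) (u : C(I, E)) =>
      (⟨fun x => B (A x) (u x), by fun_prop⟩ : C(I, F)))
      (by intros; ext; simp) (by intros; ext; simp) (by intros; ext; simp)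
      (by intros; ext; simp)) ‖B‖ (by
    intro A u
    rw [ContinuousMap.norm_le _ (by positivity)]
    intro x
    simp only [LinearMap.mk₂_apply, ContinuousMap.coe_mk]
    refine (B.le_opNorm₂ _ _).trans ?_
    gcongr
    · exact A.norm_coe_le_norm x
    · exact u.norm_coe_le_norm x)

@[simp] lemma appCLM_apply (B : G →L[ℝ] E →L[ℝ] F) (A : C(I, G)) (u : C(I, E)) (x : I) :
    appCLM B A u x = B (A x) (u x) := rfl

lemma appCLM_contDiff (B : G →L[ℝ] E →L[ℝ] F) {X : Type*} [NormedAddCommGroup X]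
    [NormedSpace ℝ X] {n : ℕ} {g : X → C(I, G)} (hg : ContDiff ℝ n g) :
    ContDiff ℝ n (fun x => appCLM B (g x)) := by
  have h : ContDiff ℝ n (fun x => appCLM B x) := by fun_prop
  exact h.comp hg

/-- bundle a continuous function -/
def mkC (f : E → F) (h : Continuous f) : C(E, F) := ⟨f, h⟩

@[simp] lemma mkC_apply (f : E → F) (h : Continuous f) (x : E) : mkC f h x = f x := rfl

lemma nem_hasFDerivAt (B : G →L[ℝ] E →L[ℝ] F) (hB : ‖B‖ ≤ 1) (f : C(E, F)) (f' : C(E, G))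
    (hf : ∀ x, HasFDerivAt f (B (f' x)) x)
    (u : C(I, E)) : HasFDerivAt (fun u : C(I, E) => f.comp u) (appCLM B (f'.comp u)) u := by
  rw [hasFDerivAt_iff_isLittleO_nhds_zero, Asymptotics.isLittleO_iff]
  intro c hc
  have hcont : Continuous (fun u : C(I, E) => f'.comp u) := ContinuousMap.continuous_postcomp f'
  obtain ⟨δ, hδ, H⟩ := Metric.continuous_iff.1 hcont u c hc
  filter_upwards [Metric.ball_mem_nhds (0 : C(I, E)) hδ] with h hh
  rw [ContinuousMap.norm_le _ (by positivity)]
  intro x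
  have hseg : ∀ y ∈ segment ℝ (u x) (u x + h x), ‖B (f' y) - B (f' (u x))‖ ≤ c := by
    intro y hy
    rw [segment_eq_image'] at hy
    obtain ⟨s, hs, rfl⟩ := hy
    have h1 := H (u + s • h) (by
      rw [dist_eq_norm, add_sub_cancel_left, norm_smul]
      have : ‖h‖ < δ := by simpa using hh
      have h2 : ‖s‖ ≤ 1 := by rw [Real.norm_eq_abs, abs_of_nonneg hs.1]; exact hs.2
      nlinarith [norm_nonneg h])
    rw [dist_eq_norm] at h1
    have := (ContinuousMap.norm_coe_le_norm _ x).trans h1.le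
    rw [← map_sub]
    refine (B.le_of_opNorm_le hB _).trans ?_
    simpa using this
  have := (convex_segment (u x) (u x + h x)).norm_image_sub_le_of_norm_hasFDerivWithin_le'
    (f := f) (f' := fun y => B (f' y)) (φ := B (f' (u x))) (C := c)
    (fun y _ => (hf y).hasFDerivWithinAt) hseg (left_mem_segment ℝ _ _) (right_mem_segment ℝ _ _)
  simp only [add_sub_cancel_left] at this
  refine le_trans ?_ (this.trans (mul_le_mul_of_nonneg_left (h.norm_coe_le_norm x) hc.le))
  simp

theorem nem_contDiff (n : ℕ) : ∀ {F : Type u} [NormedAddCommGroup F] [NormedSpace ℝ F]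
    (f : C(E, F)), ContDiff ℝ n f → ContDiff ℝ n (fun u : C(I, E) => f.comp u) := by
  induction n with
  | zero =>
    intro F _ _ f hf
    exact contDiff_zero.2 (ContinuousMap.continuous_postcomp f)
  | succ n ih =>
    intro F _ _ f hf
    push_cast at hf ⊢
    obtain ⟨f', hf', hd⟩ := contDiff_succ_iff_hasFDerivAt.1 hf
    rw [contDiff_succ_iff_hasFDerivAt]
    have h1 := ih (mkC f' hf'.continuous) hf'
    have h2 := appCLM_contDiff (ContinuousLinearMap.id ℝ (E →L[ℝ] F)) h1
    exact ⟨_, h2, fun u => nem_hasFDerivAt _ ContinuousLinearMap.norm_id_le f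
      (mkC f' hf'.continuous) hd u⟩

/-- Volterra integration -/
def volt : C(I, E) →L[ℝ] C(I, E) :=
  LinearMap.mkContinuous
    { toFun := fun u => ⟨fun x => ∫ r in (0:ℝ)..x, u (projIcc 0 1 zero_le_one r), by
        have : Continuous fun y : ℝ => ∫ r in (0:ℝ)..y, u (projIcc 0 1 zero_le_one r) :=
          intervalIntegral.continuous_primitive
            (fun a b => (u.continuous.comp continuous_projIcc).intervalIntegrable a b) 0
        exact this.comp continuous_subtype_val⟩
      map_add' := by
        intro u v; ext x
        exact intervalIntegral.integral_add
          ((u.continuous.comp continuous_projIcc).intervalIntegrable _ _)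
          ((v.continuous.comp continuous_projIcc).intervalIntegrable _ _)
      map_smul' := by
        intro c u; ext x
        exact intervalIntegral.integral_smul c _ } 1 (by
    intro u
    rw [ContinuousMap.norm_le _ (by positivity)]
    intro x
    have := intervalIntegral.norm_integral_le_of_norm_le_const (a := 0) (b := (x:ℝ)) (C := ‖u‖)
      (f := fun r => u (projIcc 0 1 zero_le_one r)) (fun r _ => u.norm_coe_le_norm _)
    refine this.trans ?_
    rw [sub_zero, abs_of_nonneg x.2.1, one_mul]
    exact mul_le_of_le_one_right (norm_nonneg _) x.2.2)

lemma volt_apply (u : C(I, E)) (x : I) :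
    volt u x = ∫ r in (0:ℝ)..x, u (projIcc 0 1 zero_le_one r) := rfl

lemma volt_norm_le (u : C(I, E)) : ‖volt u‖ ≤ ‖u‖ := by
  have := (volt (E := E)).le_of_opNorm_le (LinearMap.mkContinuous_norm_le _ zero_le_one _) u
  simpa using this

lemma appCLM_norm_le (B : G →L[ℝ] E →L[ℝ] F) (hB : ‖B‖ ≤ 1) (A : C(I, G)) (u : C(I, E)) :
    ‖appCLM B A u‖ ≤ ‖A‖ * ‖u‖ := by
  rw [ContinuousMap.norm_le _ (by positivity)]
  intro x
  refine (B.le_of_opNorm₂_le_of_le hB (A.norm_coe_le_norm x) (u.norm_coe_le_norm x)).trans ?_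
  simp

/-- constant paths -/
def constCLM : E →L[ℝ] C(I, E) :=
  LinearMap.mkContinuous
    { toFun := fun p => ContinuousMap.const I p
      map_add' := by intros; ext; simp
      map_smul' := by intros; ext; simp } 1 (by
    intro p
    rw [ContinuousMap.norm_le _ (by positivity)]
    intro x; simp)

@[simp] lemma constCLM_apply (p : E) (x : I) : constCLM p x = p := rfl

/-- the implicit equation -/
def gfun (Fc : C(E, E)) (z : (ℝ × E) × C(I, E)) : C(I, E) :=
  z.2 - constCLM z.1.2 - z.1.1 • volt (Fc.comp z.2)

lemma gfun_contDiff (Fc : C(E, E)) (n : ℕ) (hF : ContDiff ℝ n Fc) : ContDiff ℝ n (gfun Fc) := by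
  have h1 := nem_contDiff n Fc hF
  have h2 : ContDiff ℝ n (fun u : C(I, E) => volt u) := by fun_prop
  have h3 : ContDiff ℝ n (fun u : E => constCLM u) := by fun_prop
  have h4 : ContDiff ℝ n (fun z : (ℝ × E) × C(I, E) => volt (Fc.comp z.2)) :=
    h2.comp (h1.comp contDiff_snd)
  have h5 : ContDiff ℝ n (fun z : (ℝ × E) × C(I, E) => constCLM z.1.2) :=
    h3.comp (contDiff_snd.comp contDiff_fst)
  unfold gfun
  exact (contDiff_snd.sub h5).sub ((contDiff_fst.comp contDiff_fst).smul h4)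

lemma gfun_unique (Fc : C(E, E)) (M : ℝ) (hM0 : 0 ≤ M) (hM : ∀ x y, ‖Fc x - Fc y‖ ≤ M * ‖x - y‖)
    (q : ℝ × E) (hq : |q.1| * M < 1) (u w : C(I, E)) (hu : gfun Fc (q, u) = 0)
    (hw : gfun Fc (q, w) = 0) : u = w := by
  have h1 : u - w = q.1 • volt (Fc.comp u - Fc.comp w) := by
    rw [map_sub, smul_sub]
    simp only [gfun] at hu hw
    rw [sub_eq_zero] at hu hw
    rw [← hu, ← hw]; abel
  have h2 : ‖Fc.comp u - Fc.comp w‖ ≤ M * ‖u - w‖ := by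
    rw [ContinuousMap.norm_le _ (by positivity)]
    intro x
    exact (hM _ _).trans (mul_le_mul_of_nonneg_left ((u - w).norm_coe_le_norm x) hM0)
  have h3 : ‖u - w‖ ≤ |q.1| * (M * ‖u - w‖) := by
    conv_lhs => rw [h1, norm_smul, Real.norm_eq_abs]
    exact mul_le_mul_of_nonneg_left ((volt_norm_le _).trans h2) (abs_nonneg _)
  have h4 : ‖u - w‖ = 0 := by
    by_contra h
    have : 0 < ‖u - w‖ := lt_of_le_of_ne (norm_nonneg _) (Ne.symm h)
    nlinarith
  exact sub_eq_zero.1 (norm_eq_zero.1 h4)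

lemma gfun_path [CompleteSpace E] (Fc : C(E, E)) (Ψ : ℝ → E → E) (h0 : ∀ p, Ψ 0 p = p)
    (hΨ : ∀ t p, HasDerivAt (fun s => Ψ s p) (Fc (Ψ t p)) t) (q : ℝ × E)
    (u : C(I, E)) (hu : ∀ x, u x = Ψ (q.1 * x) q.2) : gfun Fc (q, u) = 0 := by
  ext x
  have hd : ∀ r : ℝ, HasDerivAt (fun r : ℝ => Ψ (q.1 * r) q.2) (q.1 • Fc (Ψ (q.1 * r) q.2)) r := by
    intro r
    have := (hΨ (q.1 * r) q.2).scomp r ((hasDerivAt_id r).const_mul q.1)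
    simpa using! this
  have hc : Continuous (fun r : ℝ => Ψ (q.1 * r) q.2) :=
    continuous_iff_continuousAt.2 fun r => (hd r).continuousAt
  have hint := intervalIntegral.integral_eq_sub_of_hasDerivAt (a := 0) (b := (x : ℝ))
    (fun r _ => hd r) (by
      have := ((Fc.continuous.comp hc).const_smul q.1)
      exact this.intervalIntegrable _ _)
  have hcongr : ∫ r in (0:ℝ)..x, Fc (u (projIcc 0 1 zero_le_one r))
      = ∫ r in (0:ℝ)..x, Fc (Ψ (q.1 * r) q.2) := by
    apply intervalIntegral.integral_congr
    intro r hr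
    rw [uIcc_of_le x.2.1] at hr
    have : r ∈ Icc (0:ℝ) 1 := ⟨hr.1, hr.2.trans x.2.2⟩
    simp only [hu, projIcc_of_mem zero_le_one this]
  simp only [gfun, ContinuousMap.sub_apply, ContinuousMap.smul_apply, volt_apply, constCLM_apply,
    ContinuousMap.comp_apply, hcongr, ContinuousMap.zero_apply]
  rw [intervalIntegral.integral_smul] at hint
  rw [hint, hu]
  simp [h0]

lemma isInvertible_id_sub {X : Type*} [NormedAddCommGroup X] [NormedSpace ℝ X] [CompleteSpace X]
    (T : X →L[ℝ] X) (hT : ‖T‖ < 1) : (ContinuousLinearMap.id ℝ X - T).IsInvertible := by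
  obtain ⟨U, hU⟩ := isUnit_one_sub_of_norm_lt_one hT
  exact ⟨ContinuousLinearEquiv.ofUnit U, hU⟩

lemma gfun_inv [CompleteSpace E] (Fc : C(E, E)) (n : ℕ) (hn : n ≠ 0) (hF : ContDiff ℝ n Fc) (M : ℝ)
    (hM0 : 0 ≤ M) (hM : ∀ p, ‖fderiv ℝ Fc p‖ ≤ M) (q : ℝ × E) (hq : |q.1| * M < 1) (u : C(I, E)) :
    (fderiv ℝ (gfun Fc) (q, u) ∘L .inr ℝ (ℝ × E) C(I, E)).IsInvertible := by
  have hn1 : (n : WithTop ℕ∞) ≠ 0 := by exact_mod_cast hn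
  have hn2 : (1 : WithTop ℕ∞) ≤ n := by exact_mod_cast Nat.one_le_iff_ne_zero.2 hn
  have hg : HasFDerivAt (gfun Fc) (fderiv ℝ (gfun Fc) (q, u)) (q, u) :=
    ((gfun_contDiff Fc n hF).differentiable hn1 _).hasFDerivAt
  have h1 := hg.comp u (hasFDerivAt_prodMk_right q u)
  have hF' : Continuous (fderiv ℝ Fc) := hF.continuous_fderiv hn1
  set A := (mkC (fderiv ℝ Fc) hF').comp u with hA
  set T := q.1 • (volt ∘L appCLM (ContinuousLinearMap.id ℝ (E →L[ℝ] E)) A) with hT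
  have hnem := nem_hasFDerivAt (ContinuousLinearMap.id ℝ (E →L[ℝ] E))
    ContinuousLinearMap.norm_id_le Fc (mkC (fderiv ℝ Fc) hF')
    (fun x => (hF.differentiable hn1 x).hasFDerivAt) u
  have hv : HasFDerivAt (fun u : C(I, E) => volt u) volt (Fc.comp u) := by
    apply ContinuousLinearMap.hasFDerivAt
  have h2 : HasFDerivAt (fun y => gfun Fc (q, y)) (ContinuousLinearMap.id ℝ _ - T) u := by
    unfold gfun
    exact ((hasFDerivAt_id u).sub_const (constCLM q.2)).fun_sub ((hv.comp u hnem).const_smul q.1)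
  have h3 := h1.unique h2
  rw [h3]
  have hTn : ‖T‖ < 1 := by
    refine lt_of_le_of_lt (ContinuousLinearMap.opNorm_le_bound _ (by positivity) ?_) hq
    intro y
    simp only [hT, smul_apply, norm_smul, Real.norm_eq_abs,
      ContinuousLinearMap.comp_apply]
    rw [mul_assoc]
    gcongr
    refine (volt_norm_le _).trans ((appCLM_norm_le _ ContinuousLinearMap.norm_id_le _ _).trans ?_)
    gcongr
    rw [ContinuousMap.norm_le _ hM0]
    intro x
    exact hM _
  exact isInvertible_id_sub T hTn

lemma small_time [CompleteSpace E] (F : E → E) (n : ℕ) (hn : n ≠ 0) (hF : ContDiff ℝ n F) (M : ℝ)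
    (hM0 : 0 ≤ M) (hM : ∀ p, ‖fderiv ℝ F p‖ ≤ M)
    (Ψ : ℝ → E → E) (h0 : ∀ p, Ψ 0 p = p)
    (hΨ : ∀ t p, HasDerivAt (fun s => Ψ s p) (F (Ψ t p)) t) (q : ℝ × E) (hq : |q.1| * M < 1) :
    ContDiffAt ℝ n (fun q : ℝ × E => Ψ q.1 q.2) q := by
  have hn1 : (n : WithTop ℕ∞) ≠ 0 := by exact_mod_cast hn
  have hL : ∀ x y, ‖F x - F y‖ ≤ M * ‖x - y‖ := fun x y =>
    convex_univ.norm_image_sub_le_of_norm_fderiv_le (fun z _ => hF.differentiable hn1 z)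
      (fun z _ => hM z) (mem_univ y) (mem_univ x)
  have hcΨ : ∀ p, Continuous (fun s => Ψ s p) := fun p =>
    continuous_iff_continuousAt.2 fun r => (hΨ r p).continuousAt
  set Fc := mkC F hF.continuous with hFc
  let path : ℝ × E → C(I, E) := fun q => ⟨fun x => Ψ (q.1 * x) q.2,
    (hcΨ q.2).comp (by fun_prop)⟩
  have hpath : ∀ q, gfun Fc (q, path q) = 0 := fun q =>
    gfun_path Fc Ψ h0 hΨ q (path q) fun x => rfl
  have cdf : ContDiffAt ℝ n (gfun Fc) (q, path q) := (gfun_contDiff Fc n hF).contDiffAt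
  have inv := gfun_inv Fc n hn hF M hM0 hM q hq (path q)
  have hψ := cdf.contDiffAt_implicitFunction hn1 inv
  have hev := cdf.eventually_apply_implicitFunction hn1 inv
  set ψ := cdf.implicitFunction hn1 inv
  have hev2 : ∀ᶠ q' : ℝ × E in 𝓝 q, |q'.1| * M < 1 :=
    (continuous_fst.abs.mul continuous_const).continuousAt.eventually (gt_mem_nhds hq)
  have heq : ∀ᶠ q' in 𝓝 q, Ψ q'.1 q'.2 = ψ q' 1 := by
    filter_upwards [hev, hev2] with q' h1 h2
    rw [hpath] at h1
    rw [gfun_unique Fc M hM0 hL q' h2 (ψ q') (path q') h1 (hpath q')]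
    simp [path]
  have hone : ContDiff ℝ n (fun u : C(I, E) => u 1) := by
    have : ContDiff ℝ n (fun u : C(I, E) => ContinuousMap.evalCLM ℝ (1 : I) u) := by fun_prop
    exact this
  exact (hone.contDiffAt.comp q hψ).congr_of_eventuallyEq heq

lemma semigroup (F : E → E) (M : NNReal) (hF : LipschitzWith M F) (Ψ : ℝ → E → E)
    (h0 : ∀ p, Ψ 0 p = p) (hΨ : ∀ t p, HasDerivAt (fun s => Ψ s p) (F (Ψ t p)) t)
    (a b : ℝ) (p : E) : Ψ (a + b) p = Ψ a (Ψ b p) := by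
  have h : (fun s => Ψ (s + b) p) = fun s => Ψ s (Ψ b p) := by
    refine ODE_solution_unique_univ (v := fun _ => F) (s := fun _ => univ) (K := M) (t₀ := 0)
      (fun _ => hF.lipschitzOnWith) (fun t => ⟨?_, mem_univ _⟩) (fun t => ⟨hΨ t _, mem_univ _⟩) ?_
    · exact (hΨ (t + b) p).comp_add_const t b
    · simp [h0]
  exact congrFun h a

lemma all_time [CompleteSpace E] (F : E → E) (n : ℕ) (hn : n ≠ 0) (hF : ContDiff ℝ n F) (M : ℝ)
    (hM0 : 0 ≤ M) (hM : ∀ p, ‖fderiv ℝ F p‖ ≤ M) (hL : LipschitzWith M.toNNReal F)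
    (Ψ : ℝ → E → E) (h0 : ∀ p, Ψ 0 p = p)
    (hΨ : ∀ t p, HasDerivAt (fun s => Ψ s p) (F (Ψ t p)) t) :
    ContDiff ℝ n (fun q : ℝ × E => Ψ q.1 q.2) := by
  have key : ∀ N : ℕ, ∀ q : ℝ × E, |q.1| * M < N + 1 →
      ContDiffAt ℝ n (fun q : ℝ × E => Ψ q.1 q.2) q := by
    intro N
    induction N with
    | zero =>
      intro q hq
      exact small_time F n hn hF M hM0 hM Ψ h0 hΨ q (by simpa using hq)
    | succ N ih =>
      intro q hq
      push_cast at hq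
      have hN : (0:ℝ) < (N:ℝ) + 2 := by positivity
      have e : (fun q : ℝ × E => Ψ q.1 q.2) = fun q : ℝ × E =>
          Ψ (q.1 * (1 / (N + 2))) (Ψ (q.1 * ((N + 1) / (N + 2))) q.2) := by
        funext q
        rw [← semigroup F _ hL Ψ h0 hΨ]
        congr 1
        field_simp
        ring
      have h1 : ContDiffAt ℝ n (fun q : ℝ × E => Ψ (q.1 * ((N + 1) / (N + 2))) q.2) q := by
        have := ih (q.1 * ((N + 1) / (N + 2)), q.2) (by
          simp only [abs_mul]
          rw [abs_of_nonneg (by positivity : (0:ℝ) ≤ ((N:ℝ) + 1) / (N + 2))]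
          rw [mul_right_comm, mul_div_assoc', div_lt_iff₀ hN]
          nlinarith [(by positivity : (0:ℝ) < (N:ℝ) + 1)])
        exact ContDiffAt.comp (g := fun q : ℝ × E => Ψ q.1 q.2)
          (f := fun q : ℝ × E => (q.1 * (((N:ℝ) + 1) / (N + 2)), q.2)) q this (by fun_prop)
      have h2 := small_time F n hn hF M hM0 hM Ψ h0 hΨ
        (q.1 * (1 / (N + 2)), Ψ (q.1 * ((N + 1) / (N + 2))) q.2) (by
          simp only [abs_mul]
          rw [abs_of_nonneg (by positivity : (0:ℝ) ≤ 1 / ((N:ℝ) + 2))]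
          rw [mul_right_comm, mul_div_assoc', div_lt_iff₀ hN]
          linarith)
      rw [e]
      exact ContDiffAt.comp (g := fun q : ℝ × E => Ψ q.1 q.2)
          (f := fun q : ℝ × E => (q.1 * (1 / ((N:ℝ) + 2)), Ψ (q.1 * ((N + 1) / (N + 2))) q.2)) q h2
          (ContDiffAt.prodMk (by fun_prop) h1)
  rw [contDiff_iff_contDiffAt]
  intro q
  obtain ⟨N, hN⟩ := exists_nat_gt (|q.1| * M)
  exact key N q (by linarith)

lemma global_flow [CompleteSpace E] (F : E → E) (M : NNReal) (hb : ∀ p, ‖F p‖ ≤ M)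
    (hL : LipschitzWith M F) :
    ∃ Ψ : ℝ → E → E, (∀ p, Ψ 0 p = p) ∧ ∀ t p, HasDerivAt (fun s => Ψ s p) (F (Ψ t p)) t := by
  have loc : ∀ (T : ℝ) (p : E), ∃ α : ℝ → E, 0 < T → α 0 = p ∧
      ∀ t ∈ Ioo (-T) T, HasDerivAt α (F (α t)) t := by
    intro T p
    by_cases hT : 0 < T
    · have hP : IsPicardLindelof (fun _ => F) (tmin := -T) (tmax := T) ⟨0, by constructor <;> linarith⟩ p
          (M * T.toNNReal) 0 M M := by
        refine IsPicardLindelof.of_time_independent (fun x _ => hb x) hL.lipschitzOnWith ?_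
        simp [hT.le]
      obtain ⟨α, h1, h2⟩ := hP.exists_eq_forall_mem_Icc_hasDerivWithinAt₀
      exact ⟨α, fun _ => ⟨h1, fun t ht => (h2 t (Ioo_subset_Icc_self ht)).hasDerivAt
        (Icc_mem_nhds ht.1 ht.2)⟩⟩
    · exact ⟨fun _ => p, fun h => absurd h hT⟩
  choose α hα using loc
  have agree : ∀ (T T' : ℝ) (p : E), 0 < T → T ≤ T' → EqOn (α T p) (α T' p) (Ioo (-T) T) := by
    intro T T' p hT hTT
    refine ODE_solution_unique_of_mem_Ioo (v := fun _ => F) (s := fun _ => univ) (K := M) (t₀ := 0)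
      (fun _ _ => hL.lipschitzOnWith) (by constructor <;> linarith) ?_ ?_ ?_
    · intro t ht
      exact ⟨(hα T p hT).2 t ht, mem_univ _⟩
    · intro t ht
      exact ⟨(hα T' p (by linarith)).2 t ⟨by linarith [ht.1], by linarith [ht.2]⟩, mem_univ _⟩
    · rw [(hα T p hT).1, (hα T' p (by linarith)).1]
  have mem : ∀ t : ℝ, t ∈ Ioo (-(|t| + 1)) (|t| + 1) := fun t =>
    ⟨by linarith [neg_abs_le t], by linarith [le_abs_self t]⟩
  refine ⟨fun t p => α (|t| + 1) p t, fun p => (hα _ p (by positivity)).1, fun t p => ?_⟩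
  have e1 : α (|t| + 1) p t = α (|t| + 2) p t := agree _ _ p (by positivity) (by linarith) (mem t)
  simp only [e1]
  have hd := (hα (|t| + 2) p (by positivity)).2 t
    ⟨by linarith [neg_abs_le t], by linarith [le_abs_self t]⟩
  refine hd.congr_of_eventuallyEq ?_
  have hnb : ∀ᶠ s in 𝓝 t, |s| < |t| + 1 :=
    (continuous_abs.tendsto t).eventually (gt_mem_nhds (by linarith))
  filter_upwards [hnb] with s hs
  exact agree _ _ p (by positivity) (by linarith) (mem s)

lemma contDiff_partial (m r : ℕ) (f : ℝ × E → G) (hf : ContDiff ℝ ((m + r : ℕ)) f) :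
    ContDiff ℝ r (fun q : ℝ × E => iteratedFDeriv ℝ m (fun y => f (q.1, y)) q.2) := by
  induction m generalizing r with
  | zero =>
    simp only [iteratedFDeriv_zero_eq_comp, Function.comp_def]
    simp only [zero_add] at hf
    exact (continuousMultilinearCurryFin0 ℝ E G).symm.contDiff.comp hf
  | succ m ih =>
    have h := ih (r + 1) (by convert hf using 2; ring)
    simp only [iteratedFDeriv_succ_eq_comp_left, Function.comp_def]
    have hq : ContDiff ℝ r (fun q : ℝ × E =>
        fderiv ℝ (iteratedFDeriv ℝ m (fun y => f (q.1, y))) q.2) := by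
      refine ContDiff.fderiv (m := ((r + 1 : ℕ) : WithTop ℕ∞))
        (f := fun (q : ℝ × E) y => iteratedFDeriv ℝ m (fun y => f (q.1, y)) y) (g := Prod.snd) ?_
        contDiff_snd (by push_cast; exact le_rfl)
      exact h.comp (g := fun q : ℝ × E => iteratedFDeriv ℝ m (fun y => f (q.1, y)) q.2)
        (f := fun q : (ℝ × E) × E => (q.1.1, q.2)) (by fun_prop)
    exact (LinearIsometryEquiv.contDiff (𝕜 := ℝ)
      (E := E →L[ℝ] ContinuousMultilinearMap ℝ (fun _ : Fin m => E) G)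
      (F := ContinuousMultilinearMap ℝ (fun _ : Fin (m + 1) => E) G)
      (continuousMultilinearCurryLeftEquiv ℝ (fun _ : Fin (m + 1) => E) G).symm).comp hq

lemma swap (g h : ℝ × E → G) (hg : ContDiff ℝ 2 g)
    (hd : ∀ t p, HasDerivAt (fun s => g (s, p)) (h (t, p)) t) (t : ℝ) (p : E) :
    HasDerivAt (fun s => fderiv ℝ (fun y => g (s, y)) p) (fderiv ℝ (fun y => h (t, y)) p) t := by
  have hgd : Differentiable ℝ g := hg.differentiable (by norm_num)
  have hgd2 : Differentiable ℝ (fderiv ℝ g) :=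
    (hg.fderiv_right (m := 1) (by norm_num)).differentiable (by norm_num)
  have i1 : ∀ s y, HasFDerivAt (fun y : E => ((s, y) : ℝ × E)) (ContinuousLinearMap.inr ℝ ℝ E) y :=
    fun s y => hasFDerivAt_prodMk_right s y
  have i2 : ∀ s y, HasDerivAt (fun s : ℝ => ((s, y) : ℝ × E)) ((1 : ℝ), (0 : E)) s :=
    fun s y => (hasDerivAt_id s).prodMk (hasDerivAt_const s y)
  have e1 : (fun s => fderiv ℝ (fun y => g (s, y)) p) =
      fun s => (fderiv ℝ g (s, p)).comp (ContinuousLinearMap.inr ℝ ℝ E) := by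
    funext s
    exact ((hgd (s, p)).hasFDerivAt.comp p (i1 s p)).fderiv
  have e2 : (fun y => h (t, y)) = fun y => fderiv ℝ g (t, y) ((1 : ℝ), (0 : E)) := by
    funext y
    exact (hd t y).unique ((hgd (t, y)).hasFDerivAt.comp_hasDerivAt t (i2 t y))
  rw [e1, e2]
  have d1 : HasDerivAt (fun s => fderiv ℝ g (s, p))
      (fderiv ℝ (fderiv ℝ g) (t, p) ((1 : ℝ), (0 : E))) t :=
    (hgd2 (t, p)).hasFDerivAt.comp_hasDerivAt t (i2 t p)
  have d1' := d1.clm_comp (hasDerivAt_const t (ContinuousLinearMap.inr ℝ ℝ E))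
  have d2 : HasFDerivAt (fun y => fderiv ℝ g (t, y))
      ((fderiv ℝ (fderiv ℝ g) (t, p)).comp (ContinuousLinearMap.inr ℝ ℝ E)) p :=
    (hgd2 (t, p)).hasFDerivAt.comp p (i1 t p)
  have d2' := d2.clm_apply (hasFDerivAt_const ((1 : ℝ), (0 : E)) p)
  rw [d2'.fderiv]
  convert d1' using 1
  have sym : IsSymmSndFDerivAt ℝ g (t, p) :=
    hg.contDiffAt.isSymmSndFDerivAt (by simp [minSmoothness_of_isRCLikeNormedField])
  ext v
  simp [sym.eq (0, v) (1, 0)]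

lemma deriv_J (k : ℕ) (g h : ℝ × E → G) (hg : ContDiff ℝ ((k + 1 : ℕ)) g)
    (hd : ∀ t p, HasDerivAt (fun s => g (s, p)) (h (t, p)) t) (m : ℕ) (hm : m ≤ k) :
    ∀ t p, HasDerivAt (fun s => iteratedFDeriv ℝ m (fun y => g (s, y)) p)
      (iteratedFDeriv ℝ m (fun y => h (t, y)) p) t := by
  induction m with
  | zero =>
    intro t p
    simp only [iteratedFDeriv_zero_eq_comp, Function.comp_def]
    exact ((continuousMultilinearCurryFin0 ℝ E G).symm.toContinuousLinearEquiv.hasFDerivAt.comp_hasDerivAt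
      t (hd t p) :)
  | succ m ih =>
    intro t p
    have ih' := ih (by omega)
    simp only [iteratedFDeriv_succ_eq_comp_left, Function.comp_def]
    have hs := swap (fun q : ℝ × E => iteratedFDeriv ℝ m (fun y => g (q.1, y)) q.2)
      (fun q : ℝ × E => iteratedFDeriv ℝ m (fun y => h (q.1, y)) q.2)
      (contDiff_partial m 2 g (hg.of_le (by exact_mod_cast (by omega : m + 2 ≤ k + 1)))) ih' t p
    exact ((continuousMultilinearCurryLeftEquiv ℝ (fun _ : Fin (m+1) => E) G).symm.toContinuousLinearEquiv.hasFDerivAt.comp_hasDerivAt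
      t hs :)

/-- combinatorial constant -/
def KK (j : ℕ) : ℝ := ∑ i ∈ Finset.range j, (j.choose (i + 1) : ℝ) * (i + 1).factorial

lemma KK_nonneg (j : ℕ) : 0 ≤ KK j := Finset.sum_nonneg fun _ _ => by positivity

lemma est (j : ℕ) (F ψ : E → E) (M D : ℝ) (hM0 : 0 ≤ M) (hF : ContDiff ℝ ((j + 1 : ℕ)) F)
    (hψ : ContDiff ℝ ((j + 1 : ℕ)) ψ) (hM : ∀ m ≤ j + 1, ∀ p, ‖iteratedFDeriv ℝ m F p‖ ≤ M)
    (hD : 1 ≤ D) (p : E) (hJ : ∀ l, 1 ≤ l → l ≤ j → ‖iteratedFDeriv ℝ l ψ p‖ ≤ D) :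
    ‖iteratedFDeriv ℝ (j + 1) (fun y => F (ψ y)) p‖ ≤
      M * ‖iteratedFDeriv ℝ (j + 1) ψ p‖ + KK j * M * D ^ (j + 1) := by
  have hFd : Differentiable ℝ F := hF.differentiable (by simp)
  have hψd : Differentiable ℝ ψ := hψ.differentiable (by simp)
  have hF1 : ContDiff ℝ j (fderiv ℝ F) := hF.fderiv_right (by simp)
  have hψ1 : ContDiff ℝ j (fderiv ℝ ψ) := hψ.fderiv_right (by simp)
  have hψj : ContDiff ℝ j ψ := hψ.of_le (by exact_mod_cast Nat.le_succ j)
  rw [← norm_iteratedFDeriv_fderiv]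
  have e : fderiv ℝ (fun y => F (ψ y)) = fun y =>
      ContinuousLinearMap.compL ℝ E E E (fderiv ℝ F (ψ y)) (fderiv ℝ ψ y) := by
    funext y
    exact ((hFd (ψ y)).hasFDerivAt.comp y (hψd y).hasFDerivAt).fderiv
  rw [e]
  refine (ContinuousLinearMap.norm_iteratedFDeriv_le_of_bilinear_of_le_one _ (N := j)
    (hF1.comp hψj) hψ1 p le_rfl (ContinuousLinearMap.norm_compL_le ℝ E E E)).trans ?_
  rw [Finset.sum_range_succ', add_comm]
  have h0 : ‖iteratedFDeriv ℝ 0 (fderiv ℝ F ∘ ψ) p‖ ≤ M := by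
    rw [norm_iteratedFDeriv_zero]
    have := hM 1 (by omega) (ψ p)
    rwa [← zero_add 1, ← norm_iteratedFDeriv_fderiv, norm_iteratedFDeriv_zero] at this
  refine add_le_add ?_ ?_
  · simp only [Nat.choose_zero_right, Nat.cast_one, one_mul, Nat.sub_zero]
    rw [← norm_iteratedFDeriv_fderiv (f := ψ)]
    gcongr
  · rw [KK, Finset.sum_mul, Finset.sum_mul]
    refine Finset.sum_le_sum fun i hi => ?_
    have hi' : i < j := Finset.mem_range.1 hi
    have a1 : ‖iteratedFDeriv ℝ (i + 1) (fderiv ℝ F ∘ ψ) p‖ ≤ (i + 1).factorial * M * D ^ (i + 1) := by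
      refine norm_iteratedFDeriv_comp_le (N := j) hF1 hψj (by exact_mod_cast hi') p ?_ ?_
      · intro l hl
        rw [norm_iteratedFDeriv_fderiv]
        exact hM _ (by omega) _
      · intro l hl hl'
        exact (hJ l hl (by omega)).trans (le_self_pow₀ hD (by omega))
    have a2 : ‖iteratedFDeriv ℝ (j - (i + 1)) (fderiv ℝ ψ) p‖ ≤ D := by
      rw [norm_iteratedFDeriv_fderiv]
      exact hJ _ (by omega) (by omega)
    have a3 : D ^ (i + 1) * D ≤ D ^ (j + 1) := by
      rw [← pow_succ]
      exact pow_le_pow_right₀ hD (by omega)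
    calc _ ≤ (j.choose (i + 1) : ℝ) * ((i + 1).factorial * M * D ^ (i + 1)) * D := by gcongr
      _ = (j.choose (i + 1) : ℝ) * (i + 1).factorial * M * (D ^ (i + 1) * D) := by ring
      _ ≤ _ := by gcongr

lemma initial_bound (j : ℕ) (p : E) : ‖iteratedFDeriv ℝ (j + 1) (fun y : E => y) p‖ ≤ 1 := by
  rw [← norm_iteratedFDeriv_fderiv]
  have e : fderiv ℝ (fun y : E => y) = fun _ => ContinuousLinearMap.id ℝ E := by
    funext y; exact fderiv_fun_id
  rw [e]
  rcases Nat.eq_zero_or_pos j with rfl | hj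
  · rw [norm_iteratedFDeriv_zero]; exact ContinuousLinearMap.norm_id_le
  · rw [iteratedFDeriv_const_of_ne hj.ne']; simp

/-- inductive constants -/
def CC (M : ℝ) : ℕ → ℝ
  | 0 => 1
  | j + 1 => CC M j + Real.log (1 + KK j) + CC M j * (j + 1) + M

lemma CC_pos (M : ℝ) (hM : 0 < M) (j : ℕ) : 0 < CC M j := by
  induction j with
  | zero => simp [CC]
  | succ j ih =>
    have := Real.log_nonneg (by linarith [KK_nonneg j] : 1 ≤ 1 + KK j)
    rw [CC]; positivity

lemma bound (k : ℕ) (F : E → E) (M : ℝ) (hM0 : 0 < M) (hF : ContDiff ℝ ((k + 1 : ℕ)) F)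
    (hM : ∀ m ≤ k + 1, ∀ p, ‖iteratedFDeriv ℝ m F p‖ ≤ M) (Ψ : ℝ → E → E)
    (h0 : ∀ p, Ψ 0 p = p) (hΨ : ∀ t p, HasDerivAt (fun s => Ψ s p) (F (Ψ t p)) t)
    (hC : ContDiff ℝ ((k + 1 : ℕ)) (fun q : ℝ × E => Ψ q.1 q.2)) (j : ℕ) :
    j ≤ k → ∀ t, 0 ≤ t → ∀ p, ∀ m, 1 ≤ m → m ≤ j →
      ‖iteratedFDeriv ℝ m (Ψ t) p‖ ≤ Real.exp (CC M j * (1 + t)) := by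
  induction j with
  | zero => intro _ t ht p m h1 h2; omega
  | succ j ih =>
    intro hj t ht p m h1 h2
    have ih' := ih (by omega)
    have cp := CC_pos M hM0 j
    have lp := Real.log_nonneg (by linarith [KK_nonneg j] : 1 ≤ 1 + KK j)
    rcases Nat.lt_or_ge j m with hm | hm
    swap
    · refine (ih' t ht p m h1 hm).trans (Real.exp_le_exp.2 ?_)
      gcongr
      rw [CC]
      have : 0 ≤ CC M j * (j + 1) := by positivity
      linarith
    obtain rfl : m = j + 1 := by omega
    set D := Real.exp (CC M j * (1 + t)) with hDdef
    have hD1 : 1 ≤ D := Real.one_le_exp (by positivity)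
    have hder := deriv_J k (fun q : ℝ × E => Ψ q.1 q.2) (fun q : ℝ × E => F (Ψ q.1 q.2)) hC hΨ
      (j + 1) hj
    have hψ : ∀ s, ContDiff ℝ ((j + 1 : ℕ)) (Ψ s) := fun s =>
      (hC.comp (f := fun y : E => (s, y)) (by fun_prop)).of_le (by exact_mod_cast (by omega : j + 1 ≤ k + 1))
    have hgr := norm_le_gronwallBound_of_norm_deriv_right_le (a := 0) (b := t)
      (f := fun s => iteratedFDeriv ℝ (j + 1) (Ψ s) p)
      (f' := fun s => iteratedFDeriv ℝ (j + 1) (fun y => F (Ψ s y)) p)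
      (δ := 1) (K := M) (ε := KK j * M * D ^ (j + 1))
      (fun s _ => (hder s p).continuousAt.continuousWithinAt)
      (fun s _ => (hder s p).hasDerivWithinAt)
      (by
        have : Ψ 0 = fun y => y := funext h0
        simp only [this]
        exact initial_bound j p)
      (by
        intro s hs
        refine est j F (Ψ s) M D hM0.le (hF.of_le (by exact_mod_cast (by omega : j + 1 ≤ k + 1)))
          (hψ s) (fun m hm => hM m (by omega)) hD1 p ?_
        intro l hl hl'
        refine (ih' s hs.1 p l hl hl').trans (Real.exp_le_exp.2 ?_)
        have := hs.2.le
        gcongr)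
      t ⟨ht, le_rfl⟩
    refine hgr.trans ?_
    rw [gronwallBound_of_K_ne_0 hM0.ne']
    simp only [sub_zero]
    have hDp : 1 ≤ D ^ (j + 1) := one_le_pow₀ hD1
    have kn := KK_nonneg j
    have hee : 1 ≤ Real.exp (M * t) := Real.one_le_exp (by positivity)
    have e1 : KK j * M * D ^ (j + 1) / M = KK j * D ^ (j + 1) := by field_simp
    rw [e1]
    calc _ ≤ (1 + KK j) * D ^ (j + 1) * Real.exp (M * t) := by
            have : 0 ≤ KK j * D ^ (j + 1) := by positivity
            nlinarith
      _ = Real.exp (Real.log (1 + KK j) + (j + 1) * (CC M j * (1 + t)) + M * t) := by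
            rw [Real.exp_add, Real.exp_add, Real.exp_log (by linarith), hDdef, ← Real.exp_nat_mul]
            push_cast
            rfl
      _ ≤ _ := by
            refine Real.exp_le_exp.2 ?_
            rw [CC]
            have := mul_nonneg cp.le ht
            have := mul_nonneg lp ht
            nlinarith

end

end FlowAux

theorem flow_higher_derivative_gronwall_bound
    (n k : ℕ) (hn : 1 ≤ n) (M : ℝ) (hM : 0 < M) :
    ∃ C : ℝ, 0 < C ∧
      ∀ (L : ℝ), 0 ≤ L →
      ∀ (F : EuclideanSpace ℝ (Fin n) → EuclideanSpace ℝ (Fin n)),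
        ContDiff ℝ (k + 1) F →
        (∀ (m : ℕ), m ≤ k + 1 → ∀ p, ‖iteratedFDeriv ℝ m F p‖ ≤ M) →
      ∀ (Φ : ℝ → EuclideanSpace ℝ (Fin n) → EuclideanSpace ℝ (Fin n)),
        (∀ p, Φ 0 p = p) →
        (∀ t ∈ Set.Icc (0:ℝ) L, ∀ p, HasDerivAt (fun s => Φ s p) (F (Φ t p)) t) →
      ∀ (m : ℕ), 1 ≤ m → m ≤ k →
      ∀ t ∈ Set.Icc (0:ℝ) L, ∀ p,
        ‖iteratedFDeriv ℝ m (Φ t) p‖ ≤ Real.exp (C * (1 + t)) := by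
  refine ⟨FlowAux.CC M k, FlowAux.CC_pos M hM k, ?_⟩
  intro L hL F hF hFM Φ hΦ0 hΦ m hm1 hmk t ht p
  have hF' : ContDiff ℝ ((k + 1 : ℕ)) F := by exact_mod_cast hF
  have hFd : Differentiable ℝ F := hF'.differentiable (by simp)
  have hb : ∀ p, ‖F p‖ ≤ M := fun p => by
    have := hFM 0 (by omega) p
    rwa [norm_iteratedFDeriv_zero] at this
  have hd : ∀ p, ‖fderiv ℝ F p‖ ≤ M := fun p => by
    have := hFM 1 (by omega) p
    rwa [← zero_add 1, ← norm_iteratedFDeriv_fderiv, norm_iteratedFDeriv_zero] at this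
  have hLip : LipschitzWith M.toNNReal F := by
    refine lipschitzWith_of_nnnorm_fderiv_le hFd fun p => ?_
    rw [← NNReal.coe_le_coe, coe_nnnorm, Real.coe_toNNReal _ hM.le]
    exact hd p
  obtain ⟨Ψ, h0, hΨ⟩ := FlowAux.global_flow F M.toNNReal
    (fun p => by rw [Real.coe_toNNReal _ hM.le]; exact hb p) hLip
  have hC := FlowAux.all_time F (k + 1) (by omega) hF' M hM.le hd hLip Ψ h0 hΨ
  have e : Φ t = Ψ t := by
    funext y
    exact ODE_solution_unique (v := fun _ => F) (K := M.toNNReal) (a := 0) (b := L)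
      (f := fun s => Φ s y) (g := fun s => Ψ s y) (fun _ => hLip)
      (fun s hs => (hΦ s hs y).continuousAt.continuousWithinAt)
      (fun s hs => (hΦ s ⟨hs.1, hs.2.le⟩ y).hasDerivWithinAt)
      (fun s _ => (hΨ s y).continuousAt.continuousWithinAt)
      (fun s _ => (hΨ s y).hasDerivWithinAt) (by simp [hΦ0, h0]) ht
  rw [e]
  exact FlowAux.bound k F M hM hF' hFM Ψ h0 hΨ hC k le_rfl t ht.1 p m hm1 hmk
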